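/- arXiv:1112.4401 — 3 statements merged into one kernel-verified Lean document; each statement's English description precedes it below -/
import Mathlib

section
/- Let N > 1, K, λ be real numbers, I ⊆ ℝ an open interval, T : I → ℝ a differentiable function satisfying T′(t) = K + T(t)²/(N−1) for all t ∈ I, and v : I → ℝ a three times differentiable function. Then for every t ∈ I one has λ²v(t)²/(N−1) + ((N+1)/(N−1))·λ·v(t)·v″(t) + (N/(N−1))·v″(t)² + (K−λ)·v′(t)² − v′(t)·v‴(t) = −v′(t)·E′(t) + (1/(N−1))·E(t)·(N·v″(t) + T(t)·v′(t) + λ·v(t)), where E(t) := v″(t) − T(t)·v′(t) + λ·v(t) and E′ is its derivative. -/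
/-- For the 1-D Bakry–Qian model, with `T' = K + T²/(N-1)`, the coefficient `a₃`
factors through the model equation: with `E(t) = v''(t) - T(t)v'(t) + λ v(t)`,
`λ²v²/(N-1) + ((N+1)/(N-1))λ v v'' + (N/(N-1))v''² + (K-λ)v'² - v'v'''
  = -v' E' + (1/(N-1)) E (N v'' + T v' + λ v)`. -/
theorem stmt_0 (N K lam a b : ℝ) (hN : 1 < N) (T v : ℝ → ℝ)
    (hT : ∀ t ∈ Set.Ioo a b, HasDerivAt T (K + (T t) ^ 2 / (N - 1)) t)
    (hv : ∀ t ∈ Set.Ioo a b, DifferentiableAt ℝ v t)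
    (hv' : ∀ t ∈ Set.Ioo a b, DifferentiableAt ℝ (deriv v) t)
    (hv'' : ∀ t ∈ Set.Ioo a b, DifferentiableAt ℝ (deriv (deriv v)) t) :
    ∀ t ∈ Set.Ioo a b,
      lam ^ 2 * (v t) ^ 2 / (N - 1)
        + (N + 1) / (N - 1) * lam * v t * deriv (deriv v) t
        + N / (N - 1) * (deriv (deriv v) t) ^ 2
        + (K - lam) * (deriv v t) ^ 2
        - deriv v t * deriv (deriv (deriv v)) t
      = - deriv v t *
          deriv (fun s => deriv (deriv v) s - T s * deriv v s + lam * v s) t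
        + 1 / (N - 1) * (deriv (deriv v) t - T t * deriv v t + lam * v t)
          * (N * deriv (deriv v) t + T t * deriv v t + lam * v t) := by
  intro t ht
  have hE : HasDerivAt (fun s => deriv (deriv v) s - T s * deriv v s + lam * v s)
      (deriv (deriv (deriv v)) t
        - ((K + (T t) ^ 2 / (N - 1)) * deriv v t + T t * deriv (deriv v) t)
        + lam * deriv v t) t :=
    ((hv'' t ht).hasDerivAt.sub ((hT t ht).mul (hv' t ht).hasDerivAt)).add
      ((hv t ht).hasDerivAt.const_mul lam)
  have hN' : N - 1 ≠ 0 := by linarith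
  rw [hE.deriv]
  field_simp
  ring
end

section
/- Let K, λ and N > 1 be real numbers, I ⊆ ℝ an open interval, T : I → ℝ differentiable with T′(t) = K + T(t)²/(N−1) on I, and v : I → ℝ three times differentiable with v″(t) − T(t)·v′(t) + λ·v(t) = 0 and v′(t) ≠ 0 for all t ∈ I. Let h be a differentiable real-valued function on an open set containing v(I), and define f(t) = −h(v(t))·v′(t) and X(t) = λ·v(t)/v′(t). Then for every t ∈ I: v′(t)²·(h′(v(t)) − h(v(t))²) − ((N+1)/(N−1))·h(v(t))·λ·v(t) − (2N/(N−1))·h(v(t))·v″(t) + 2(K−λ) − 2·v‴(t)/v′(t) = f(t)·(((3N−1)/(N−1))·T(t) − 2·X(t)) − 2·T(t)·((N/(N−1))·T(t) − X(t)) − f(t)² − f′(t). -/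
/-- With `T' = K + T²/(N-1)`, a model eigenfunction `v` (`v'' - T v' + λ v = 0`,
`v' ≠ 0`, three times differentiable), `f(t) = -h(v(t))·v'(t)`, `X(t) = λ v(t)/v'(t)`:
`v'²(h'(v) - h(v)²) - ((N+1)/(N-1))h(v)λv - (2N/(N-1))h(v)v'' + 2(K-λ) - 2v'''/v'
 = f(((3N-1)/(N-1))T - 2X) - 2T((N/(N-1))T - X) - f² - f'`. -/
theorem stmt_8 (N K lam a b : ℝ) (hN : 1 < N) (T v h : ℝ → ℝ) (U : Set ℝ)
    (hT : ∀ t ∈ Set.Ioo a b, HasDerivAt T (K + (T t) ^ 2 / (N - 1)) t)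
    (hv : ∀ t ∈ Set.Ioo a b, DifferentiableAt ℝ v t)
    (hv' : ∀ t ∈ Set.Ioo a b, DifferentiableAt ℝ (deriv v) t)
    (hv'' : ∀ t ∈ Set.Ioo a b, DifferentiableAt ℝ (deriv (deriv v)) t)
    (heq : ∀ t ∈ Set.Ioo a b, deriv (deriv v) t - T t * deriv v t + lam * v t = 0)
    (hv'0 : ∀ t ∈ Set.Ioo a b, deriv v t ≠ 0)
    (hU : IsOpen U) (hVU : v '' Set.Ioo a b ⊆ U)
    (hh : ∀ u ∈ U, DifferentiableAt ℝ h u) :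
    ∀ t ∈ Set.Ioo a b,
      (deriv v t) ^ 2 * (deriv h (v t) - (h (v t)) ^ 2)
        - (N + 1) / (N - 1) * h (v t) * lam * v t
        - 2 * N / (N - 1) * h (v t) * deriv (deriv v) t
        + 2 * (K - lam)
        - 2 * deriv (deriv (deriv v)) t / deriv v t
      = (-h (v t) * deriv v t) *
          ((3 * N - 1) / (N - 1) * T t - 2 * (lam * v t / deriv v t))
        - 2 * T t * (N / (N - 1) * T t - lam * v t / deriv v t)
        - (-h (v t) * deriv v t) ^ 2
        - deriv (fun s => -h (v s) * deriv v s) t := by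
  intro t ht
  have hv1 : HasDerivAt v (deriv v t) t := (hv t ht).hasDerivAt
  have hv2 : HasDerivAt (deriv v) (deriv (deriv v) t) t := (hv' t ht).hasDerivAt
  have hh1 : HasDerivAt h (deriv h (v t)) (v t) :=
    (hh (v t) (hVU (Set.mem_image_of_mem v ht))).hasDerivAt
  have hf : deriv (fun s => -h (v s) * deriv v s) t
      = -(deriv h (v t) * deriv v t) * deriv v t + -h (v t) * deriv (deriv v) t :=
    ((hh1.comp t hv1).neg.mul hv2).deriv
  have hode : deriv (deriv v) =ᶠ[nhds t] fun s => T s * deriv v s - lam * v s := by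
    filter_upwards [isOpen_Ioo.mem_nhds ht] with s hs
    linarith [heq s hs]
  have hv3 : deriv (deriv (deriv v)) t
      = (K + (T t) ^ 2 / (N - 1)) * deriv v t + T t * deriv (deriv v) t - lam * deriv v t :=
    hode.deriv_eq.trans (((hT t ht).mul hv2).sub (hv1.const_mul lam)).deriv
  have hp : deriv v t ≠ 0 := hv'0 t ht
  have hN1 : N - 1 ≠ 0 := by linarith
  rw [hf, hv3, hode.eq_of_nhds]
  field_simp
  ring
end

section
/- Let K > 0 and N > 1 be real numbers, set α = √(K/(N−1)) and T(t) = (N−1)·α·tan(αt). Let a < b with [a,b] ⊂ (−π/(2α), π/(2α)), and suppose λ > 0 is such that there exists a twice continuously differentiable function v on [a,b], not identically zero, with v″(t) − T(t)·v′(t) = −λ·v(t) on (a,b) and v′(a) = v′(b) = 0. Then λ ≥ inf { μ > 0 : there exists a twice continuously differentiable w on [−(b−a)/2, (b−a)/2], not identically zero, with w″(t) − T(t)·w′(t) = −μ·w(t) on (−(b−a)/2, (b−a)/2) and w′(−(b−a)/2) = w′((b−a)/2) = 0 }. -/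
open Set

/-- A function with nonnegative derivative at every point of `[a, b]` is monotone there. -/
lemma monotoneOn_Icc_of_hasDerivAt_nonneg {f f' : ℝ → ℝ} {a b : ℝ}
    (hf : ∀ t ∈ Icc a b, HasDerivAt f (f' t) t) (hf' : ∀ t ∈ Icc a b, 0 ≤ f' t) :
    MonotoneOn f (Icc a b) :=
  monotoneOn_of_hasDerivWithinAt_nonneg (convex_Icc a b)
    (fun t ht => (hf t ht).continuousAt.continuousWithinAt)
    (fun t ht => (hf t (interior_subset ht)).hasDerivWithinAt)
    (fun t ht => hf' t (interior_subset ht))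

/-- If `g` vanishes at `a` and is positive on `(a, b)`, its derivative at `a` is nonnegative. -/
lemma HasDerivAt.nonneg_of_pos_right {g : ℝ → ℝ} {d a b : ℝ} (hab : a < b)
    (hg : HasDerivAt g d a) (ha : g a = 0) (hpos : ∀ t ∈ Ioo a b, 0 < g t) : 0 ≤ d := by
  have h : Filter.Tendsto (slope g a) (nhdsWithin a (Ioi a)) (nhds d) :=
    (hasDerivWithinAt_iff_tendsto_slope' (by simp)).1 hg.hasDerivWithinAt
  refine ge_of_tendsto h ?_
  filter_upwards [Ioo_mem_nhdsGT hab] with t ht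
  rw [slope_def_field, ha]
  exact div_nonneg (by linarith [hpos t ht]) (by linarith [ht.1])

/-- If `g` vanishes at `b` and is positive on `(a, b)`, its derivative at `b` is nonpositive. -/
lemma HasDerivAt.nonpos_of_pos_left {g : ℝ → ℝ} {d a b : ℝ} (hab : a < b)
    (hg : HasDerivAt g d b) (hb : g b = 0) (hpos : ∀ t ∈ Ioo a b, 0 < g t) : d ≤ 0 := by
  have h : Filter.Tendsto (slope g b) (nhdsWithin b (Iio b)) (nhds d) :=
    (hasDerivWithinAt_iff_tendsto_slope' (by simp)).1 hg.hasDerivWithinAt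
  refine le_of_tendsto h ?_
  filter_upwards [Ioo_mem_nhdsLT hab] with t ht
  rw [slope_def_field, hb]
  exact div_nonpos_of_nonneg_of_nonpos (by linarith [hpos t ht]) (by linarith [ht.2])

/-- A continuous function vanishing at both ends of `[a, b]` and positive at some point of it is
positive between two of its zeros. -/
lemma exists_pos_between_zeros {g : ℝ → ℝ} {a b t : ℝ} (hg : ContinuousOn g (Icc a b))
    (ha : g a = 0) (hb : g b = 0) (ht : t ∈ Icc a b) (hpos : 0 < g t) :
    ∃ c d, a ≤ c ∧ c < d ∧ d ≤ b ∧ g c = 0 ∧ g d = 0 ∧ ∀ s ∈ Ioo c d, 0 < g s := by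
  have hg1 : ContinuousOn g (Icc a t) := hg.mono (Icc_subset_Icc_right ht.2)
  have hg2 : ContinuousOn g (Icc t b) := hg.mono (Icc_subset_Icc_left ht.1)
  have hc1 : IsCompact (Icc a t ∩ g ⁻¹' {0}) :=
    isCompact_Icc.of_isClosed_subset
      (hg1.preimage_isClosed_of_isClosed isClosed_Icc isClosed_singleton) inter_subset_left
  have hc2 : IsCompact (Icc t b ∩ g ⁻¹' {0}) :=
    isCompact_Icc.of_isClosed_subset
      (hg2.preimage_isClosed_of_isClosed isClosed_Icc isClosed_singleton) inter_subset_left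
  obtain ⟨c, ⟨hcm, hc0⟩, hcu⟩ := hc1.exists_isGreatest ⟨a, ⟨le_rfl, ht.1⟩, ha⟩
  obtain ⟨d, ⟨hdm, hd0⟩, hdl⟩ := hc2.exists_isLeast ⟨b, ⟨ht.2, le_rfl⟩, hb⟩
  have hc0' : g c = 0 := hc0
  have hd0' : g d = 0 := hd0
  have hct : c < t := lt_of_le_of_ne hcm.2 (by rintro rfl; linarith)
  have htd : t < d := lt_of_le_of_ne hdm.1 (by rintro rfl; linarith)
  refine ⟨c, d, hcm.1, hct.trans htd, hdm.2, hc0, hd0, fun s hs => ?_⟩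
  by_contra! hle
  rcases le_total s t with hst | hts
  · obtain ⟨x, hx, hx0⟩ := intermediate_value_Icc hst
      (hg1.mono (Icc_subset_Icc_left (hcm.1.trans hs.1.le))) ⟨hle, hpos.le⟩
    have := hcu ⟨⟨(hcm.1.trans hs.1.le).trans hx.1, hx.2⟩, hx0⟩
    linarith [hs.1, hx.1]
  · obtain ⟨x, hx, hx0⟩ := intermediate_value_Icc' hts
      (hg2.mono (Icc_subset_Icc_right (hs.2.le.trans hdm.2))) ⟨hle, hpos.le⟩
    have := hdl ⟨⟨hx.1, hx.2.trans (hs.2.le.trans hdm.2)⟩, hx0⟩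
    linarith [hs.2, hx.2]

/-- If the Wronskian of `g` and `φ` is nonnegative and `φ > 0`, then `g / φ` is monotone. -/
lemma monotoneOn_div_of_wronskian_nonneg {g G φ Φ : ℝ → ℝ} {a b : ℝ}
    (hg : ∀ t ∈ Icc a b, HasDerivAt g (G t) t) (hφ : ∀ t ∈ Icc a b, HasDerivAt φ (Φ t) t)
    (hpos : ∀ t ∈ Icc a b, 0 < φ t) (hW : ∀ t ∈ Icc a b, 0 ≤ G t * φ t - g t * Φ t) :
    MonotoneOn (fun t => g t / φ t) (Icc a b) :=
  monotoneOn_Icc_of_hasDerivAt_nonneg (f' := fun t => (G t * φ t - g t * Φ t) / φ t ^ 2)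
    (fun t ht => (hg t ht).fun_div (hφ t ht) (hpos t ht).ne')
    (fun t ht => div_nonneg (hW t ht) (sq_nonneg _))

/-- Comparison of `y'' = (V - lam) y` on an interval with midpoint `c ≥ 0` and on the centered
interval of the same length, for a potential `V` which is a nondecreasing function of `|t|`: there
is no solution positive inside `(a, b)` and vanishing at the ends together with an even solution
positive on the closed centered interval. -/
lemma false_of_positive_solutions_of_nonneg {V g G φ Φ : ℝ → ℝ} {lam P a b l c : ℝ}
    (hV : ∀ x y, |x| ≤ |y| → |y| < P → V x ≤ V y)
    (ha : a = c - l) (hb : b = c + l) (hl : 0 < l) (hc : 0 ≤ c) (haP : -P < a) (hbP : b < P)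
    (hg : ∀ t ∈ Icc a b, HasDerivAt g (G t) t)
    (hG : ∀ t ∈ Icc a b, HasDerivAt G ((V t - lam) * g t) t)
    (hga : g a = 0) (hgb : g b = 0) (hgpos : ∀ t ∈ Ioo a b, 0 < g t)
    (hφ : ∀ t ∈ Icc (-l) l, HasDerivAt φ (Φ t) t)
    (hΦ : ∀ t ∈ Icc (-l) l, HasDerivAt Φ ((V t - lam) * φ t) t)
    (hφpos : ∀ t ∈ Icc (-l) l, 0 < φ t) (heven : ∀ t ∈ Icc (-l) l, φ (-t) = φ t) : False := by
  have hab : a < b := by linarith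
  have hG0 : 0 ≤ G a := (hg a ⟨le_rfl, hab.le⟩).nonneg_of_pos_right hab hga hgpos
  have hG1 : G b ≤ 0 := (hg b ⟨hab.le, le_rfl⟩).nonpos_of_pos_left hab hgb hgpos
  have hg0 : ∀ t ∈ Icc a b, 0 ≤ g t := by
    intro t ht
    rcases eq_or_lt_of_le ht.1 with h | h
    · rw [← h, hga]
    · rcases eq_or_lt_of_le ht.2 with h' | h'
      · rw [h', hgb]
      · exact (hgpos t ⟨h, h'⟩).le
  have hsh : ∀ t ∈ Icc a b, t - c ∈ Icc (-l) l := fun t ht => by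
    constructor <;> linarith [ht.1, ht.2]
  have hφc : ∀ t ∈ Icc a b, HasDerivAt (fun s => φ (s - c)) (Φ (t - c)) t := fun t ht =>
    (hφ _ (hsh t ht)).comp_sub_const t c
  have hΦc : ∀ t ∈ Icc a b,
      HasDerivAt (fun s => Φ (s - c)) ((V (t - c) - lam) * φ (t - c)) t := fun t ht =>
    (hΦ _ (hsh t ht)).comp_sub_const t c
  set W : ℝ → ℝ := fun t => G t * φ (t - c) - g t * Φ (t - c) with hWdef
  have hW : ∀ t ∈ Icc a b,
      HasDerivAt W ((V t - V (t - c)) * (g t * φ (t - c))) t := fun t ht => by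
    refine (((hG t ht).mul (hφc t ht)).sub ((hg t ht).mul (hΦc t ht))).congr_deriv ?_
    ring
  have hWa : W a = G a * φ (a - c) := by simp [hWdef, hga]
  have hWb : W b ≤ 0 := by
    have h1 : W b = G b * φ (b - c) := by simp [hWdef, hgb]
    rw [h1]
    exact mul_nonpos_of_nonpos_of_nonneg hG1 (hφpos _ (hsh b ⟨hab.le, le_rfl⟩)).le
  have hφa : 0 < φ (a - c) := hφpos _ (hsh a ⟨le_rfl, hab.le⟩)
  have hVle : ∀ t ∈ Icc a b, c / 2 ≤ t → V (t - c) ≤ V t := fun t ht h => by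
    have h0 : 0 ≤ t := by linarith
    refine hV _ _ ?_ ?_
    · rw [abs_of_nonneg h0]; exact abs_le.2 ⟨by linarith, by linarith⟩
    · rw [abs_of_nonneg h0]; linarith [ht.2]
  have hWmono : ∀ x, a ≤ x → c / 2 ≤ x → MonotoneOn W (Icc x b) := fun x hax hx => by
    have hsub : Icc x b ⊆ Icc a b := Icc_subset_Icc_left hax
    refine monotoneOn_Icc_of_hasDerivAt_nonneg (fun t ht => hW t (hsub ht)) fun t ht => ?_
    exact mul_nonneg (sub_nonneg.2 (hVle t (hsub ht) (hx.trans ht.1)))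
      (mul_nonneg (hg0 t (hsub ht)) (hφpos _ (hsh t (hsub ht))).le)
  rcases le_or_gt (c / 2) a with hca | hca
  · have hm := hWmono a le_rfl hca
    have hmono := monotoneOn_div_of_wronskian_nonneg hg hφc (fun t ht => hφpos _ (hsh t ht))
      (fun t ht => by
        have h1 := hm ⟨le_rfl, hab.le⟩ ht ht.1
        have h2 : 0 ≤ W a := by rw [hWa]; positivity
        exact h2.trans h1)
    have hmid : c ∈ Icc a b := ⟨by linarith, by linarith⟩
    have h1 := hmono hmid ⟨hab.le, le_rfl⟩ hmid.2
    simp only [hgb, zero_div] at h1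
    have := div_pos (hgpos c ⟨by linarith, by linarith⟩) (hφpos _ (hsh c hmid))
    linarith
  · have hsub1 : Icc a l ⊆ Icc a b := Icc_subset_Icc_right (by linarith)
    have hsub2 : Icc a l ⊆ Icc (-l) l := Icc_subset_Icc_left (by linarith)
    have hal : a < l := by linarith
    have hU : ∀ t ∈ Icc a l, HasDerivAt (fun s => G s * φ s - g s * Φ s) 0 t := fun t ht => by
      refine (((hG t (hsub1 ht)).mul (hφ t (hsub2 ht))).sub
        ((hg t (hsub1 ht)).mul (hΦ t (hsub2 ht)))).congr_deriv ?_
      ring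
    have hUc : ∀ t ∈ Icc a l, G t * φ t - g t * Φ t = G a * φ a := fun t ht => by
      have h := constant_of_has_deriv_right_zero
        (fun s hs => (hU s hs).continuousAt.continuousWithinAt)
        (fun s hs => (hU s (Ico_subset_Icc_self hs)).hasDerivWithinAt) t ht
      simpa [hga] using h
    have hmono := monotoneOn_div_of_wronskian_nonneg (fun t ht => hg t (hsub1 ht))
      (fun t ht => hφ t (hsub2 ht)) (fun t ht => hφpos t (hsub2 ht)) (fun t ht => by
        rw [hUc t ht]
        exact mul_nonneg hG0 (hφpos a (hsub2 ⟨le_rfl, hal.le⟩)).le)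
    have hGa : 0 < G a := by
      refine lt_of_le_of_ne hG0 fun h0 => ?_
      have hanti := monotoneOn_div_of_wronskian_nonneg (g := fun t => -g t) (G := fun t => -G t)
        (fun t ht => (hg t (hsub1 ht)).neg)
        (fun t ht => hφ t (hsub2 ht)) (fun t ht => hφpos t (hsub2 ht)) (fun t ht => by
          have := hUc t ht
          rw [← h0] at this
          linarith)
      have hm : (a + l) / 2 ∈ Icc a l := ⟨by linarith, by linarith⟩
      have h1 := hanti ⟨le_rfl, hal.le⟩ hm hm.1
      simp only [hga, neg_zero, zero_div, neg_div] at h1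
      have := div_pos (hgpos ((a + l) / 2) ⟨by linarith, by linarith⟩) (hφpos _ (hsub2 hm))
      linarith
    have hrefl : ∀ t ∈ Icc (c / 2) l, c - t ∈ Icc a l := fun t ht =>
      ⟨by linarith [ht.2], by linarith [ht.1, ht.2]⟩
    have hself : ∀ t ∈ Icc (c / 2) l, t ∈ Icc a l := fun t ht => ⟨by linarith [ht.1], ht.2⟩
    have hVe : ∀ t ∈ Icc (c / 2) l, V (-t) = V t ∧ V (c - t) = V (t - c) := fun t ht => by
      have h1 : |t| < P := abs_lt.2 ⟨by linarith [ht.1], by linarith [ht.2]⟩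
      have h2 : |t - c| < P := abs_lt.2 ⟨by linarith [ht.1], by linarith [ht.2]⟩
      have h3 : c - t = -(t - c) := by ring
      rw [h3]
      exact ⟨le_antisymm (hV _ _ (abs_neg t).le h1)
          (hV _ _ (abs_neg t).ge (by rwa [abs_neg])),
        le_antisymm (hV _ _ (abs_neg _).le h2)
          (hV _ _ (abs_neg _).ge (by rwa [abs_neg]))⟩
    have hD : MonotoneOn (fun t => W t - W (c - t)) (Icc (c / 2) l) := by
      refine monotoneOn_Icc_of_hasDerivAt_nonneg
        (f' := fun t => (V t - V (t - c)) * (g t * φ (t - c) - g (c - t) * φ t))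
        (fun t ht => ?_) fun t ht => ?_
      · have h1 := hW t (hsub1 (hself t ht))
        have h2 := (hW (c - t) (hsub1 (hrefl t ht))).comp_const_sub c t
        refine (h1.sub h2).congr_deriv ?_
        have h3 : c - t - c = -t := by ring
        rw [h3, heven t (hsub2 (hself t ht)), (hVe t ht).1, (hVe t ht).2]
        ring
      · have h1 := hmono (hrefl t ht) (hself t ht) (by linarith [ht.1])
        rw [div_le_div_iff₀ (hφpos _ (hsub2 (hrefl t ht))) (hφpos _ (hsub2 (hself t ht)))] at h1
        have h2 : φ (t - c) = φ (c - t) := by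
          rw [← heven (c - t) (hsub2 (hrefl t ht)), neg_sub]
        rw [h2]
        exact mul_nonneg (sub_nonneg.2 (hVle t (hsub1 (hself t ht)) ht.1)) (sub_nonneg.2 h1)
    have h1 := hD ⟨le_rfl, by linarith⟩ ⟨by linarith, le_rfl⟩ (by linarith : c / 2 ≤ l)
    have h2 : c - c / 2 = c / 2 := by ring
    simp only [h2, sub_self, ← ha] at h1
    have h3 := hWmono l hal.le (by linarith) ⟨le_rfl, by linarith⟩ ⟨by linarith, le_rfl⟩
      (by linarith : l ≤ b)
    have h4 : 0 < W a := by rw [hWa]; positivity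
    linarith

/-- The comparison of `false_of_positive_solutions_of_nonneg` without restriction on the position
of the interval, and with a possibly longer centered interval. -/
lemma false_of_positive_solutions {V g G φ Φ : ℝ → ℝ} {lam P a b l : ℝ}
    (hV : ∀ x y, |x| ≤ |y| → |y| < P → V x ≤ V y)
    (hab : a < b) (hl : b - a ≤ 2 * l) (haP : -P < a) (hbP : b < P)
    (hg : ∀ t ∈ Icc a b, HasDerivAt g (G t) t)
    (hG : ∀ t ∈ Icc a b, HasDerivAt G ((V t - lam) * g t) t)
    (hga : g a = 0) (hgb : g b = 0) (hgpos : ∀ t ∈ Ioo a b, 0 < g t)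
    (hφ : ∀ t ∈ Icc (-l) l, HasDerivAt φ (Φ t) t)
    (hΦ : ∀ t ∈ Icc (-l) l, HasDerivAt Φ ((V t - lam) * φ t) t)
    (hφpos : ∀ t ∈ Icc (-l) l, 0 < φ t) (heven : ∀ t ∈ Icc (-l) l, φ (-t) = φ t) : False := by
  have hsub : Icc (-((b - a) / 2)) ((b - a) / 2) ⊆ Icc (-l) l :=
    Icc_subset_Icc (by linarith) (by linarith)
  rcases le_total 0 ((a + b) / 2) with hc | hc
  · exact false_of_positive_solutions_of_nonneg (l := (b - a) / 2) hV (by ring) (by ring)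
      (by linarith) hc haP hbP hg hG hga hgb hgpos (fun t ht => hφ t (hsub ht))
      (fun t ht => hΦ t (hsub ht)) (fun t ht => hφpos t (hsub ht)) (fun t ht => heven t (hsub ht))
  · have hneg : ∀ t ∈ Icc (-b) (-a), -t ∈ Icc a b := fun t ht =>
      ⟨by linarith [ht.2], by linarith [ht.1]⟩
    have hVe : ∀ t ∈ Icc (-b) (-a), V (-t) = V t := fun t ht => by
      have h1 : |t| < P := abs_lt.2 ⟨by linarith [ht.1], by linarith [ht.2]⟩
      exact le_antisymm (hV _ _ (abs_neg t).le h1) (hV _ _ (abs_neg t).ge (by rwa [abs_neg]))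
    refine false_of_positive_solutions_of_nonneg (l := (b - a) / 2) (a := -b) (b := -a)
      (c := -((a + b) / 2)) (g := fun t => g (-t)) (G := fun t => -G (-t)) hV (by ring) (by ring)
      (by linarith) (by linarith) (by linarith) (by linarith) (fun t ht => ?_) (fun t ht => ?_)
      (by simpa using hgb) (by simpa using hga)
      (fun t ht => hgpos _ ⟨by linarith [ht.2], by linarith [ht.1]⟩) (fun t ht => hφ t (hsub ht))
      (fun t ht => hΦ t (hsub ht)) (fun t ht => hφpos t (hsub ht)) (fun t ht => heven t (hsub ht))
    · exact (HasDerivAt.scomp t (hg _ (hneg t ht)) (hasDerivAt_neg t)).congr_deriv (by simp)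
    · refine (HasDerivAt.scomp t (hG _ (hneg t ht)) (hasDerivAt_neg t)).neg.congr_deriv ?_
      rw [hVe t ht]
      simp

/-- `sin ^ 2` is Lipschitz with constant `2`. -/
lemma abs_sin_sq_sub_sin_sq_le (x y : ℝ) :
    |Real.sin x ^ 2 - Real.sin y ^ 2| ≤ 2 * |x - y| := by
  have h1 : |Real.sin x + Real.sin y| ≤ 2 :=
    (abs_add_le _ _).trans (by linarith [Real.abs_sin_le_one x, Real.abs_sin_le_one y])
  rw [sq_sub_sq, abs_mul]
  exact mul_le_mul h1 (Real.abs_sin_sub_sin_le x y) (abs_nonneg _) (by norm_num)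

lemma lipschitzWith_add_mul_sin_sq {p q M : ℝ} (hq : |q| ≤ M) :
    LipschitzWith (2 * M).toNNReal (fun x => p + q * Real.sin x ^ 2) := by
  have hM : 0 ≤ M := (abs_nonneg q).trans hq
  refine LipschitzWith.of_dist_le_mul fun x y => ?_
  rw [Real.dist_eq, Real.dist_eq, Real.coe_toNNReal _ (by positivity), add_sub_add_left_eq_sub,
    ← mul_sub, abs_mul]
  calc |q| * |Real.sin x ^ 2 - Real.sin y ^ 2| ≤ M * (2 * |x - y|) :=
        mul_le_mul hq (abs_sin_sq_sub_sin_sq_le x y) (abs_nonneg _) hM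
    _ = 2 * M * |x - y| := by ring

/-- Global existence for the Prüfer angle equation `θ' = A + B sin² θ`. -/
lemma exists_pruefer_angle {A B : ℝ → ℝ} {L : ℝ} (hL : 0 < L) (hA : ContinuousOn A (Icc (-L) L))
    (hB : ContinuousOn B (Icc (-L) L)) :
    ∃ θ : ℝ → ℝ, θ 0 = 0 ∧ ∀ t ∈ Icc (-L) L,
      HasDerivWithinAt θ (A t + B t * Real.sin (θ t) ^ 2) (Icc (-L) L) t := by
  obtain ⟨M₁, hM₁⟩ := isCompact_Icc.exists_bound_of_continuousOn hA
  obtain ⟨M₂, hM₂⟩ := isCompact_Icc.exists_bound_of_continuousOn hB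
  have h0 : (0 : ℝ) ∈ Icc (-L) L := ⟨by linarith, hL.le⟩
  have hM₁0 : 0 ≤ M₁ := (norm_nonneg _).trans (hM₁ 0 h0)
  have hM₂0 : 0 ≤ M₂ := (norm_nonneg _).trans (hM₂ 0 h0)
  have hpl : IsPicardLindelof (fun t x => A t + B t * Real.sin x ^ 2)
      (⟨0, h0⟩ : Icc (-L) L) 0 ((M₁ + M₂) * L).toNNReal 0 (M₁ + M₂).toNNReal
      (2 * M₂).toNNReal := by
    refine ⟨fun t ht => (lipschitzWith_add_mul_sin_sq (hM₂ t ht)).lipschitzOnWith,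
      fun x _ => hA.add (hB.mul continuousOn_const), fun t ht x _ => ?_, ?_⟩
    · rw [Real.coe_toNNReal _ (by positivity)]
      refine (norm_add_le _ _).trans (add_le_add (hM₁ t ht) ?_)
      rw [norm_mul]
      have h1 : ‖Real.sin x ^ 2‖ ≤ 1 := by
        rw [norm_pow]
        exact pow_le_one₀ (norm_nonneg _) (Real.abs_sin_le_one x)
      exact (mul_le_mul (hM₂ t ht) h1 (norm_nonneg _) hM₂0).trans_eq (mul_one _)
    · rw [Real.coe_toNNReal _ (by positivity), Real.coe_toNNReal _ (by positivity)]
      simp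
  exact hpl.exists_eq_forall_mem_Icc_hasDerivWithinAt₀

/-- Continuous dependence of the Prüfer angle on the coefficient. -/
lemma abs_pruefer_angle_sub_le {A B₁ B₂ θ₁ θ₂ : ℝ → ℝ} {L M ε : ℝ}
    (hM : ∀ t ∈ Icc (-L) L, |B₂ t| ≤ M) (hε : ∀ t ∈ Icc (-L) L, |B₁ t - B₂ t| ≤ ε)
    (h₁0 : θ₁ 0 = 0) (h₂0 : θ₂ 0 = 0)
    (h₁ : ∀ t ∈ Icc (-L) L,
      HasDerivWithinAt θ₁ (A t + B₁ t * Real.sin (θ₁ t) ^ 2) (Icc (-L) L) t)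
    (h₂ : ∀ t ∈ Icc (-L) L,
      HasDerivWithinAt θ₂ (A t + B₂ t * Real.sin (θ₂ t) ^ 2) (Icc (-L) L) t) :
    ∀ t ∈ Icc 0 L, |θ₁ t - θ₂ t| ≤ gronwallBound 0 (2 * M).toNNReal ε t := by
  intro t ht
  have hL : 0 ≤ L := ht.1.trans ht.2
  have hsub : Icc 0 L ⊆ Icc (-L) L := Icc_subset_Icc_left (by linarith)
  have hder : ∀ {θ : ℝ → ℝ} {d s : ℝ}, s ∈ Ico 0 L → HasDerivWithinAt θ d (Icc (-L) L) s →
      HasDerivWithinAt θ d (Ici s) s := fun hs h =>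
    h.mono_of_mem_nhdsWithin
      (Filter.mem_of_superset (Icc_mem_nhdsGE hs.2) (Icc_subset_Icc_left (by linarith [hs.1])))
  have key := dist_le_of_approx_trajectories_ODE_of_mem (a := 0) (b := L) (f := θ₁) (g := θ₂)
    (K := (2 * M).toNNReal) (v := fun t x => A t + B₂ t * Real.sin x ^ 2) (s := fun _ => univ)
    (δ := 0) (εf := ε) (εg := 0)
    (fun s hs =>
      (lipschitzWith_add_mul_sin_sq (hM s (hsub (Ico_subset_Icc_self hs)))).lipschitzOnWith)
    (fun s hs => ((h₁ s (hsub hs)).continuousWithinAt).mono hsub)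
    (fun s hs => hder hs (h₁ s (hsub (Ico_subset_Icc_self hs))))
    (fun s hs => by
      rw [Real.dist_eq, add_sub_add_left_eq_sub, ← sub_mul, abs_mul]
      have h1 : |Real.sin (θ₁ s) ^ 2| ≤ 1 := by
        rw [abs_pow]
        exact pow_le_one₀ (abs_nonneg _) (Real.abs_sin_le_one _)
      have h2 := hε s (hsub (Ico_subset_Icc_self hs))
      exact (mul_le_mul h2 h1 (abs_nonneg _) ((abs_nonneg _).trans h2)).trans_eq (mul_one _))
    (fun _ _ => mem_univ _)
    (fun s hs => ((h₂ s (hsub hs)).continuousWithinAt).mono hsub)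
    (fun s hs => hder hs (h₂ s (hsub (Ico_subset_Icc_self hs))))
    (fun s hs => by simp) (fun _ _ => mem_univ _) (by simp [h₁0, h₂0]) t ht
  simpa [Real.dist_eq] using key

/-- The Prüfer angle is odd when the coefficients are even. -/
lemma pruefer_angle_odd {A B θ : ℝ → ℝ} {L : ℝ} (hB : ContinuousOn B (Icc (-L) L))
    (hAe : ∀ t ∈ Icc (-L) L, A (-t) = A t) (hBe : ∀ t ∈ Icc (-L) L, B (-t) = B t) (h0 : θ 0 = 0)
    (h : ∀ t ∈ Icc (-L) L,
      HasDerivWithinAt θ (A t + B t * Real.sin (θ t) ^ 2) (Icc (-L) L) t) :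
    ∀ t ∈ Icc (-L) L, θ (-t) = -θ t := by
  obtain ⟨M, hM⟩ := isCompact_Icc.exists_bound_of_continuousOn hB
  have hmaps : MapsTo (fun t : ℝ => -t) (Icc (-L) L) (Icc (-L) L) := fun t ht =>
    ⟨by linarith [ht.2], by linarith [ht.1]⟩
  have h' : ∀ t ∈ Icc (-L) L, HasDerivWithinAt (fun s => -θ (-s))
      (A t + B t * Real.sin (-θ (-t)) ^ 2) (Icc (-L) L) t := fun t ht => by
    refine ((h (-t) (hmaps ht)).scomp t (hasDerivAt_neg t).hasDerivWithinAt
      hmaps).neg.congr_deriv ?_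
    rw [hAe t ht, hBe t ht, Real.sin_neg]
    simp
  have hpos : ∀ t ∈ Icc 0 L, θ (-t) = -θ t := fun t ht => by
    have := abs_pruefer_angle_sub_le (ε := 0) hM (fun t _ => by simp) h0 (by simp [h0]) h h' t ht
    rw [gronwallBound_ε0_δ0, abs_nonpos_iff] at this
    linarith
  intro t ht
  rcases le_total 0 t with h1 | h1
  · exact hpos t ⟨h1, ht.2⟩
  · have := hpos (-t) ⟨by linarith, by linarith [ht.1]⟩
    rw [neg_neg] at this
    linarith

/-- A positive solution `R` of `R' = f R` with `R 0 = 1`, even when `f` is odd. -/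
lemma exists_pos_solution_log_deriv {f : ℝ → ℝ} {L : ℝ} (hL : 0 < L)
    (hf : ContinuousOn f (Ioo (-L) L)) (hodd : ∀ t ∈ Ioo (-L) L, f (-t) = -f t) :
    ∃ R : ℝ → ℝ, R 0 = 1 ∧ (∀ t, 0 < R t) ∧ (∀ t ∈ Ioo (-L) L, HasDerivAt R (R t * f t) t) ∧
      ∀ t ∈ Ioo (-L) L, R (-t) = R t := by
  refine ⟨fun t => Real.exp (∫ s in (0 : ℝ)..t, f s), by simp, fun t => Real.exp_pos _,
    fun t ht => ?_, fun t ht => ?_⟩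
  · refine HasDerivAt.exp (intervalIntegral.integral_hasDerivAt_right ?_
      (hf.stronglyMeasurableAtFilter isOpen_Ioo t ht) (hf.continuousAt (isOpen_Ioo.mem_nhds ht)))
    refine (hf.mono ?_).intervalIntegrable
    exact ordConnected_Ioo.uIcc_subset ⟨by linarith, hL⟩ ht
  · have h1 : ∫ s in (0 : ℝ)..(-t), f s = ∫ s in (0 : ℝ)..t, f s := by
      have h2 := intervalIntegral.integral_comp_neg (a := 0) (b := t) f
      have h3 : ∫ s in (0 : ℝ)..t, f (-s) = ∫ s in (0 : ℝ)..t, -f s :=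
        intervalIntegral.integral_congr fun s hs =>
          hodd s (ordConnected_Ioo.uIcc_subset ⟨by linarith, hL⟩ ht hs)
      rw [h3, neg_zero, intervalIntegral.integral_neg] at h2
      rw [intervalIntegral.integral_symm, ← h2, neg_neg]
    simp only [h1]

/-- Polar coordinates for the system `w' = z / q`, `z' = -μ q w`. -/
lemma exists_polar_radius {q θ : ℝ → ℝ} {L μ : ℝ} (hL : 0 < L) (hq : ContinuousOn q (Icc (-L) L))
    (hpos : ∀ t ∈ Icc (-L) L, 0 < q t) (heven : ∀ t ∈ Icc (-L) L, q (-t) = q t)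
    (hodd : ∀ t ∈ Icc (-L) L, θ (-t) = -θ t)
    (h : ∀ t ∈ Icc (-L) L, HasDerivWithinAt θ
      ((q t)⁻¹ + (μ * q t - (q t)⁻¹) * Real.sin (θ t) ^ 2) (Icc (-L) L) t) :
    ∃ R : ℝ → ℝ, R 0 = 1 ∧ (∀ t, 0 < R t) ∧ (∀ t ∈ Ioo (-L) L, R (-t) = R t) ∧
      (∀ t ∈ Ioo (-L) L,
        HasDerivAt (fun s => R s * Real.sin (θ s)) (R t * Real.cos (θ t) / q t) t) ∧
      ∀ t ∈ Ioo (-L) L,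
        HasDerivAt (fun s => R s * Real.cos (θ s)) (-μ * (q t * (R t * Real.sin (θ t)))) t := by
  have hθ : ContinuousOn θ (Ioo (-L) L) := fun t ht =>
    (h t (Ioo_subset_Icc_self ht)).continuousWithinAt.mono Ioo_subset_Icc_self
  have hq' : ContinuousOn q (Ioo (-L) L) := hq.mono Ioo_subset_Icc_self
  have hne : ∀ t ∈ Ioo (-L) L, q t ≠ 0 := fun t ht => (hpos t (Ioo_subset_Icc_self ht)).ne'
  obtain ⟨R, hR0, hRpos, hR, hReven⟩ := exists_pos_solution_log_deriv
    (f := fun t => Real.sin (θ t) * Real.cos (θ t) * ((q t)⁻¹ - μ * q t)) hL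
    (((Real.continuous_sin.comp_continuousOn hθ).mul
      (Real.continuous_cos.comp_continuousOn hθ)).mul
        ((hq'.inv₀ hne).sub (continuousOn_const.mul hq')))
    (fun t ht => by
      simp only [hodd t (Ioo_subset_Icc_self ht), heven t (Ioo_subset_Icc_self ht),
        Real.sin_neg, Real.cos_neg]
      ring)
  have hθd : ∀ t ∈ Ioo (-L) L,
      HasDerivAt θ ((q t)⁻¹ + (μ * q t - (q t)⁻¹) * Real.sin (θ t) ^ 2) t := fun t ht =>
    (h t (Ioo_subset_Icc_self ht)).hasDerivAt (Icc_mem_nhds ht.1 ht.2)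
  refine ⟨R, hR0, hRpos, hReven, fun t ht => ?_, fun t ht => ?_⟩
  · refine ((hR t ht).mul (hθd t ht).sin).congr_deriv ?_
    ring
  · refine ((hR t ht).mul (hθd t ht).cos).congr_deriv ?_
    linear_combination (R t * Real.sin (θ t) * ((q t)⁻¹ - μ * q t)) *
      Real.sin_sq_add_cos_sq (θ t)

/-- Shooting alternative for `w' = z / q`, `z' = -μ q w`, `w 0 = 0`, with an even weight `q`: either
the solution for `μ = lam` has `z > 0` on `[-l, l]`, or for some `μ ∈ (0, lam]` there is a nonzero
solution with `z (-l) = z l = 0`. -/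
lemma exists_pos_solution_or_neumann_solution {q : ℝ → ℝ} {L l lam : ℝ} (hl : 0 < l) (hlL : l < L)
    (hlam : 0 ≤ lam) (hq : ContinuousOn q (Icc (-L) L))
    (hpos : ∀ t ∈ Icc (-L) L, 0 < q t) (heven : ∀ t ∈ Icc (-L) L, q (-t) = q t) :
    (∃ w z : ℝ → ℝ, (∀ t ∈ Icc (-l) l, HasDerivAt w (z t / q t) t) ∧
      (∀ t ∈ Icc (-l) l, HasDerivAt z (-lam * (q t * w t)) t) ∧
      (∀ t ∈ Icc (-l) l, z (-t) = z t) ∧ ∀ t ∈ Icc (-l) l, 0 < z t) ∨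
    ∃ μ, 0 < μ ∧ μ ≤ lam ∧ ∃ w z : ℝ → ℝ, (∀ t ∈ Icc (-l) l, HasDerivAt w (z t / q t) t) ∧
      (∀ t ∈ Icc (-l) l, HasDerivAt z (-μ * (q t * w t)) t) ∧
      w l ≠ 0 ∧ z (-l) = 0 ∧ z l = 0 := by
  have hL : 0 < L := hl.trans hlL
  have hne : ∀ t ∈ Icc (-L) L, q t ≠ 0 := fun t ht => (hpos t ht).ne'
  have hinv : ContinuousOn (fun t => (q t)⁻¹) (Icc (-L) L) := hq.inv₀ hne
  have hB : ∀ μ, ContinuousOn (fun t => μ * q t - (q t)⁻¹) (Icc (-L) L) := fun μ =>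
    (continuousOn_const.mul hq).sub hinv
  choose θ hθ0 hθ using fun μ => exists_pruefer_angle hL hinv (hB μ)
  have hodd : ∀ μ, ∀ t ∈ Icc (-L) L, θ μ (-t) = -θ μ t := fun μ =>
    pruefer_angle_odd (hB μ) (fun t ht => by rw [heven t ht]) (fun t ht => by rw [heven t ht])
      (hθ0 μ) (hθ μ)
  choose R hR0 hRpos hReven hw hz using fun μ =>
    exists_polar_radius hL hq hpos heven (hodd μ) (hθ μ)
  have hsub : Icc (-l) l ⊆ Ioo (-L) L := fun t ht => ⟨by linarith [ht.1], by linarith [ht.2]⟩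
  have hsub' : Icc 0 l ⊆ Icc (-L) L := fun t ht => ⟨by linarith [ht.1], by linarith [ht.2]⟩
  have hlmem : l ∈ Icc (-L) L := hsub' ⟨hl.le, le_rfl⟩
  have hcont : ∀ μ, ContinuousOn (θ μ) (Icc (-L) L) := fun μ t ht => (hθ μ t ht).continuousWithinAt
  have hmono : ∀ μ, 0 ≤ μ → MonotoneOn (θ μ) (Icc (-L) L) := fun μ hμ => by
    refine monotoneOn_of_hasDerivWithinAt_nonneg (convex_Icc _ _) (hcont μ)
      (fun t ht => (hθ μ t (interior_subset ht)).mono interior_subset) fun t ht => ?_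
    have h1 := hpos t (interior_subset ht)
    have h2 : (q t)⁻¹ + (μ * q t - (q t)⁻¹) * Real.sin (θ μ t) ^ 2 =
        (q t)⁻¹ * Real.cos (θ μ t) ^ 2 + μ * q t * Real.sin (θ μ t) ^ 2 := by
      rw [Real.cos_sq']; ring
    rw [h2]
    positivity
  rcases lt_or_ge (θ lam l) (Real.pi / 2) with hlt | hge
  · left
    refine ⟨_, _, fun t ht => hw lam t (hsub ht), fun t ht => hz lam t (hsub ht), fun t ht => ?_,
      fun t ht => ?_⟩
    · rw [hodd lam t (Ioo_subset_Icc_self (hsub ht)), hReven lam t (hsub ht), Real.cos_neg]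
    · have htm := Ioo_subset_Icc_self (hsub ht)
      have hlm : -l ∈ Icc (-L) L := ⟨by linarith, by linarith⟩
      have h1 := hmono lam hlam htm hlmem ht.2
      have h2 := hmono lam hlam hlm htm ht.1
      rw [hodd lam l hlmem] at h2
      exact mul_pos (hRpos lam t) (Real.cos_pos_of_mem_Ioo ⟨by linarith, by linarith⟩)
  · right
    have hzero : θ 0 l < Real.pi / 2 := by
      by_contra! hcon
      obtain ⟨t, ht, hval⟩ := intermediate_value_Icc hl.le ((hcont 0).mono hsub')
        ⟨by rw [hθ0 0]; positivity, hcon⟩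
      have hsub0 : Icc 0 l ⊆ Ioo (-L) L := fun t ht => hsub ⟨by linarith [ht.1], ht.2⟩
      have hconst := constant_of_has_deriv_right_zero
        (f := fun s => R 0 s * Real.cos (θ 0 s)) (a := 0) (b := l)
        (fun s hs => (hz 0 s (hsub0 hs)).continuousAt.continuousWithinAt)
        (fun s hs => by
          have := (hz 0 s (hsub0 (Ico_subset_Icc_self hs))).hasDerivWithinAt (s := Ici s)
          simpa using this) t ht
      rw [hval] at hconst
      simp [hθ0, hR0] at hconst
    have hθcont : ContinuousOn (fun μ => θ μ l) (Icc 0 lam) := by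
      obtain ⟨M, hM⟩ := isCompact_Icc.exists_bound_of_continuousOn hq
      intro ν _
      obtain ⟨M', hM'⟩ := isCompact_Icc.exists_bound_of_continuousOn (hB ν)
      have hbound : ∀ μ, dist (θ μ l) (θ ν l) ≤
          gronwallBound 0 (2 * M').toNNReal (|μ - ν| * M) l := fun μ => by
        refine abs_pruefer_angle_sub_le hM' (fun t ht => ?_) (hθ0 μ) (hθ0 ν) (hθ μ) (hθ ν) l
          ⟨hl.le, hlL.le⟩
        rw [sub_sub_sub_cancel_right, ← sub_mul, abs_mul]
        exact mul_le_mul_of_nonneg_left (hM t ht) (abs_nonneg _)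
      refine ContinuousAt.continuousWithinAt (tendsto_iff_dist_tendsto_zero.2 ?_)
      have hlim : Filter.Tendsto (fun μ => gronwallBound 0 (2 * M').toNNReal (|μ - ν| * M) l)
          (nhds ν) (nhds 0) := by
        have hc : Continuous fun μ => gronwallBound 0 (2 * M').toNNReal (|μ - ν| * M) l :=
          (gronwallBound_continuous_ε 0 _ l).comp (by fun_prop)
        have := hc.tendsto ν
        simpa [gronwallBound_ε0_δ0] using this
      exact squeeze_zero (fun _ => dist_nonneg) hbound hlim
    obtain ⟨μ, hμ, hval⟩ := intermediate_value_Icc hlam hθcont ⟨hzero.le, hge⟩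
    have hval' : θ μ l = Real.pi / 2 := hval
    have hμ0 : 0 < μ := lt_of_le_of_ne hμ.1 (by rintro rfl; linarith)
    refine ⟨μ, hμ0, hμ.2, _, _, fun t ht => hw μ t (hsub ht), fun t ht => hz μ t (hsub ht),
      ?_, ?_, ?_⟩
    · simp [hval', (hRpos μ l).ne']
    · simp [hodd μ l hlmem, hval']
    · simp [hval']

/-- On `(-π/(2α), π/(2α))` the cosine of `α t` is positive. -/
lemma cos_mul_pos_of_abs_lt {α t : ℝ} (hα : 0 < α) (ht : |t| < Real.pi / (2 * α)) :
    0 < Real.cos (α * t) := by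
  have h1 : |α * t| < Real.pi / 2 := by
    rw [abs_mul, abs_of_pos hα]
    calc α * |t| < α * (Real.pi / (2 * α)) := mul_lt_mul_of_pos_left ht hα
      _ = Real.pi / 2 := by field_simp
  exact Real.cos_pos_of_mem_Ioo (abs_lt.1 h1)

/-- The square of `tan (α t)` is nondecreasing in `|t|` on `(-π/(2α), π/(2α))`. -/
lemma tan_mul_sq_le_tan_mul_sq {α x y : ℝ} (hα : 0 < α) (hxy : |x| ≤ |y|)
    (hy : |y| < Real.pi / (2 * α)) : Real.tan (α * x) ^ 2 ≤ Real.tan (α * y) ^ 2 := by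
  have habs : ∀ s, Real.tan (α * |s|) ^ 2 = Real.tan (α * s) ^ 2 := fun s => by
    rcases abs_choice s with h | h <;> rw [h]
    rw [mul_neg, Real.tan_neg, neg_sq]
  rw [← habs x, ← habs y]
  have hlt : α * |y| < Real.pi / 2 :=
    calc α * |y| < α * (Real.pi / (2 * α)) := mul_lt_mul_of_pos_left hy hα
      _ = Real.pi / 2 := by field_simp
  have hle : α * |x| ≤ α * |y| := mul_le_mul_of_nonneg_left hxy hα.le
  have hx0 : 0 ≤ α * |x| := by positivity
  have hpi := Real.pi_pos
  refine pow_le_pow_left₀ (Real.tan_nonneg_of_nonneg_of_le_pi_div_two hx0 (by linarith)) ?_ 2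
  exact Real.strictMonoOn_tan.monotoneOn ⟨by linarith, by linarith⟩ ⟨by linarith, hlt⟩ hle

/-- Derivative of the square root `cos (α t) ^ (m / 2)` of the invariant density. -/
lemma hasDerivAt_cos_mul_rpow {α m t : ℝ} (hc : 0 < Real.cos (α * t)) :
    HasDerivAt (fun s => Real.cos (α * s) ^ (m / 2))
      (-(m * α * Real.tan (α * t) / 2) * Real.cos (α * t) ^ (m / 2)) t := by
  have h1 : HasDerivAt (fun s => Real.cos (α * s)) (-Real.sin (α * t) * α) t := by
    simpa using ((hasDerivAt_id t).const_mul α).cos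
  refine (h1.rpow_const (p := m / 2) (Or.inl hc.ne')).congr_deriv ?_
  rw [Real.rpow_sub_one hc.ne', Real.tan_eq_sin_div_cos]
  ring

lemma hasDerivAt_const_mul_tan_mul {α m t : ℝ} (hc : 0 < Real.cos (α * t)) :
    HasDerivAt (fun s => m * α * Real.tan (α * s))
      (m * α ^ 2 * (1 + Real.tan (α * t) ^ 2)) t := by
  have h1 : HasDerivAt (fun s => α * s) α t := by simpa using (hasDerivAt_id t).const_mul α
  refine (((Real.hasDerivAt_tan hc.ne').comp t h1).const_mul (m * α)).congr_deriv ?_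
  have h2 := Real.sin_sq_add_cos_sq (α * t)
  rw [Real.tan_eq_sin_div_cos]
  field_simp
  linear_combination -(m * α ^ 2) * h2

/-- Liouville normal form: if `v'' = T v' - lam v` and `h' = -(T / 2) h`, then `g = h v'` satisfies
`g'' = (T' / 2 + T² / 4 - lam) g`. -/
lemma hasDerivAt_liouville {T h v v' : ℝ → ℝ} {D lam t : ℝ}
    (hT : HasDerivAt T D t) (hh : HasDerivAt h (-(T t / 2) * h t) t)
    (hv : HasDerivAt v (v' t) t) (hv' : HasDerivAt v' (T t * v' t - lam * v t) t) :
    HasDerivAt (fun s => h s * v' s) (h t * (T t / 2 * v' t - lam * v t)) t ∧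
      HasDerivAt (fun s => h s * (T s / 2 * v' s - lam * v s))
        ((D / 2 + T t ^ 2 / 4 - lam) * (h t * v' t)) t := by
  constructor
  · refine (hh.mul hv').congr_deriv ?_
    ring
  · refine (hh.mul (((hT.div_const 2).mul hv').sub (hv.const_mul lam))).congr_deriv ?_
    simp only [Pi.sub_apply, Pi.mul_apply]
    ring

/-- Passing from the divergence form `z' = -μ q w`, `z = q w'` to `w'' = T w' - μ w`. -/
lemma hasDerivAt_div_sq_weight {T h w z : ℝ → ℝ} {μ t : ℝ} (h0 : h t ≠ 0)
    (hh : HasDerivAt h (-(T t / 2) * h t) t) (hz : HasDerivAt z (-μ * (h t ^ 2 * w t)) t) :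
    HasDerivAt (fun s => z s / h s ^ 2) (T t * (z t / h t ^ 2) - μ * w t) t := by
  refine (hz.fun_div (hh.fun_pow 2) (pow_ne_zero 2 h0)).congr_deriv ?_
  field_simp
  push_cast
  ring

/-- The derivative of a nonzero solution of `v'' = T v' - lam v`, `lam ≠ 0`, is not identically
zero. -/
lemma exists_deriv_ne_zero {T v v' : ℝ → ℝ} {a b lam : ℝ} (hab : a < b) (hlam : lam ≠ 0)
    (hv : ∀ t ∈ Icc a b, HasDerivAt v (v' t) t)
    (hv' : ∀ t ∈ Icc a b, HasDerivAt v' (T t * v' t - lam * v t) t)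
    (hne : ∃ t ∈ Icc a b, v t ≠ 0) : ∃ t ∈ Icc a b, v' t ≠ 0 := by
  by_contra! hcon
  obtain ⟨s, hs, hvs⟩ := hne
  have hconst : ∀ t ∈ Icc a b, v t = v a := constant_of_has_deriv_right_zero
    (fun t ht => (hv t ht).continuousAt.continuousWithinAt)
    (fun t ht => by
      have := (hv t (Ico_subset_Icc_self ht)).hasDerivWithinAt (s := Ici t)
      rwa [hcon t (Ico_subset_Icc_self ht)] at this)
  have hm : (a + b) / 2 ∈ Ioo a b := ⟨by linarith, by linarith⟩
  have hm' := Ioo_subset_Icc_self hm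
  have hloc : v' =ᶠ[nhds ((a + b) / 2)] fun _ => 0 := by
    filter_upwards [Icc_mem_nhds hm.1 hm.2] with t ht using hcon t ht
  have h1 := (hv' _ hm').unique ((hasDerivAt_const _ (0 : ℝ)).congr_of_eventuallyEq hloc)
  rw [hcon _ hm', mul_zero, zero_sub, neg_eq_zero, mul_eq_zero, hconst _ hm'] at h1
  rw [hconst s hs] at hvs
  exact h1.elim hlam hvs


/-- For `K > 0`, `N > 1`, `α = √(K/(N-1))`, `T(t) = (N-1)α·tan(αt)`, and
`[a,b] ⊂ (-π/(2α), π/(2α))`: if `λ > 0` is a Neumann eigenvalue of `v'' - T v' = -λ v` on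
`(a,b)`, then `λ` is at least the infimum of the positive Neumann eigenvalues of the same
operator on the centered interval `(-(b-a)/2, (b-a)/2)`. -/
theorem stmt_17 (K N : ℝ) (hK : 0 < K) (hN : 1 < N) (a b lam : ℝ) (hab : a < b)
    (hsub : Set.Icc a b ⊆ Set.Ioo (-(Real.pi / (2 * Real.sqrt (K / (N - 1)))))
      (Real.pi / (2 * Real.sqrt (K / (N - 1)))))
    (hlam : 0 < lam)
    (hex : ∃ v v' v'' : ℝ → ℝ,
      (∀ t ∈ Set.Icc a b, HasDerivAt v (v' t) t) ∧
      (∀ t ∈ Set.Icc a b, HasDerivAt v' (v'' t) t) ∧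
      ContinuousOn v'' (Set.Icc a b) ∧
      (∃ t ∈ Set.Icc a b, v t ≠ 0) ∧
      (∀ t ∈ Set.Ioo a b,
        v'' t - (N - 1) * Real.sqrt (K / (N - 1)) * Real.tan (Real.sqrt (K / (N - 1)) * t)
          * v' t = -lam * v t) ∧
      v' a = 0 ∧ v' b = 0) :
    lam ≥ sInf {μ : ℝ | 0 < μ ∧ ∃ w w' w'' : ℝ → ℝ,
      (∀ t ∈ Set.Icc (-((b - a) / 2)) ((b - a) / 2), HasDerivAt w (w' t) t) ∧
      (∀ t ∈ Set.Icc (-((b - a) / 2)) ((b - a) / 2), HasDerivAt w' (w'' t) t) ∧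
      ContinuousOn w'' (Set.Icc (-((b - a) / 2)) ((b - a) / 2)) ∧
      (∃ t ∈ Set.Icc (-((b - a) / 2)) ((b - a) / 2), w t ≠ 0) ∧
      (∀ t ∈ Set.Ioo (-((b - a) / 2)) ((b - a) / 2),
        w'' t - (N - 1) * Real.sqrt (K / (N - 1)) * Real.tan (Real.sqrt (K / (N - 1)) * t)
          * w' t = -μ * w t) ∧
      w' (-((b - a) / 2)) = 0 ∧ w' ((b - a) / 2) = 0} := by
  obtain ⟨v, v', v'', hv, hv', hcont, hvne, hode, hva, hvb⟩ := hex
  set α := Real.sqrt (K / (N - 1)) with hαdef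
  set m := N - 1 with hmdef
  have hm : 0 < m := by rw [hmdef]; linarith
  have hα : 0 < α := Real.sqrt_pos.2 (div_pos hK hm)
  set P := Real.pi / (2 * α) with hPdef
  set T : ℝ → ℝ := fun t => m * α * Real.tan (α * t) with hTdef
  set h : ℝ → ℝ := fun t => Real.cos (α * t) ^ (m / 2) with hhdef
  have haP : -P < a := (hsub ⟨le_rfl, hab.le⟩).1
  have hbP : b < P := (hsub ⟨hab.le, le_rfl⟩).2
  have hcos : ∀ t, |t| < P → 0 < Real.cos (α * t) := fun t ht => cos_mul_pos_of_abs_lt hα ht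
  have hh0 : ∀ t, |t| < P → 0 < h t := fun t ht => Real.rpow_pos_of_pos (hcos t ht) _
  have hh : ∀ t, |t| < P → HasDerivAt h (-(T t / 2) * h t) t := fun t ht =>
    hasDerivAt_cos_mul_rpow (hcos t ht)
  have hT : ∀ t, |t| < P → HasDerivAt T (m * α ^ 2 * (1 + Real.tan (α * t) ^ 2)) t := fun t ht =>
    hasDerivAt_const_mul_tan_mul (hcos t ht)
  have hheven : ∀ t, h (-t) = h t := fun t => by simp [hhdef]
  set V : ℝ → ℝ := fun t => m * α ^ 2 * (1 + Real.tan (α * t) ^ 2) / 2 + T t ^ 2 / 4 with hVdef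
  have hV : ∀ x y, |x| ≤ |y| → |y| < P → V x ≤ V y := fun x y hxy hy => by
    have h1 := tan_mul_sq_le_tan_mul_sq hα hxy hy
    have h2 : ∀ t, V t = m * α ^ 2 / 2 +
        (m * α ^ 2 / 2 + m ^ 2 * α ^ 2 / 4) * Real.tan (α * t) ^ 2 := fun t => by
      simp only [hVdef, hTdef]; ring
    rw [h2, h2]
    gcongr
  have habP : ∀ t ∈ Icc a b, |t| < P := fun t ht => abs_lt.2 (hsub ht)
  have hode' : ∀ t ∈ Icc a b, v'' t = T t * v' t - lam * v t := by
    have hcl : Icc a b ⊆ closure (Ioo a b) := (closure_Ioo hab.ne).ge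
    refine EqOn.of_subset_closure (s := Ioo a b) (fun t ht => ?_) hcont (fun t ht => ?_)
      Ioo_subset_Icc_self hcl
    · have := hode t ht
      simp only [hTdef]
      linarith
    · exact (((hT t (habP t ht)).continuousAt.mul (hv' t ht).continuousAt).sub
        (continuousAt_const.mul (hv t ht).continuousAt)).continuousWithinAt
  have hv2 : ∀ t ∈ Icc a b, HasDerivAt v' (T t * v' t - lam * v t) t := fun t ht => by
    rw [← hode' t ht]; exact hv' t ht
  obtain ⟨u, u', hu, hu2, hua, hub, t₀, ht₀, hut₀⟩ : ∃ u u' : ℝ → ℝ,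
      (∀ t ∈ Icc a b, HasDerivAt u (u' t) t) ∧
      (∀ t ∈ Icc a b, HasDerivAt u' (T t * u' t - lam * u t) t) ∧ u' a = 0 ∧ u' b = 0 ∧
      ∃ t ∈ Icc a b, 0 < u' t := by
    obtain ⟨t, ht, hne⟩ := exists_deriv_ne_zero hab hlam.ne' hv hv2 hvne
    rcases lt_or_gt_of_ne hne with hneg | hpos
    · refine ⟨fun s => -v s, fun s => -v' s, fun s hs => (hv s hs).neg, fun s hs =>
        (hv2 s hs).neg.congr_deriv (by ring), by simp [hva], by simp [hvb], t, ht, by simpa⟩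
    · exact ⟨v, v', hv, hv2, hva, hvb, t, ht, hpos⟩
  have hg := fun t (ht : t ∈ Icc a b) =>
    hasDerivAt_liouville (hT t (habP t ht)) (hh t (habP t ht)) (hu t ht) (hu2 t ht)
  obtain ⟨c, d, hac, hcd, hdb, hgc, hgd, hgpos⟩ := exists_pos_between_zeros
    (g := fun s => h s * u' s) (fun t ht => (hg t ht).1.continuousAt.continuousWithinAt)
    (by simp [hua]) (by simp [hub]) ht₀ (mul_pos (hh0 t₀ (habP t₀ ht₀)) hut₀)
  set l := (b - a) / 2 with hldef
  have hl : 0 < l := by rw [hldef]; linarith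
  have hlP : l < P := by rw [hldef]; linarith
  have hLP : ∀ t ∈ Icc (-((l + P) / 2)) ((l + P) / 2), |t| < P := fun t ht =>
    abs_lt.2 ⟨by linarith [ht.1], by linarith [ht.2]⟩
  have hlabs : ∀ t ∈ Icc (-l) l, |t| < P := fun t ht =>
    abs_lt.2 ⟨by linarith [ht.1], by linarith [ht.2]⟩
  rcases exists_pos_solution_or_neumann_solution (q := fun t => h t ^ 2) (L := (l + P) / 2) hl
    (by linarith) hlam.le
    (fun t ht => ((hh t (hLP t ht)).continuousAt.pow 2).continuousWithinAt)
    (fun t ht => pow_pos (hh0 t (hLP t ht)) 2) (fun t _ => by rw [hheven]) with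
    ⟨w, z, hw, hz, hzeven, hzpos⟩ | ⟨μ, hμ, hμle, w, z, hw, hz, hwl, hz0, hz1⟩
  · exfalso
    have hφ := fun t (ht : t ∈ Icc (-l) l) =>
      hasDerivAt_liouville (hT t (hlabs t ht)) (hh t (hlabs t ht)) (hw t ht)
        (hasDerivAt_div_sq_weight (hh0 t (hlabs t ht)).ne' (hh t (hlabs t ht)) (hz t ht))
    have hsub' : Icc c d ⊆ Icc a b := Icc_subset_Icc hac hdb
    refine false_of_positive_solutions hV hcd (by rw [hldef]; linarith) (by linarith) (by linarith)
      (fun t ht => (hg t (hsub' ht)).1) (fun t ht => (hg t (hsub' ht)).2) hgc hgd hgpos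
      (fun t ht => (hφ t ht).1) (fun t ht => (hφ t ht).2) (fun t ht => ?_) (fun t ht => ?_)
    · have := hh0 t (hlabs t ht)
      have := hzpos t ht
      positivity
    · simp only [hheven, hzeven t ht]
  · refine csInf_le_of_le ⟨0, fun x hx => hx.1.le⟩ ?_ hμle
    refine ⟨hμ, w, fun t => z t / h t ^ 2, fun t => T t * (z t / h t ^ 2) - μ * w t, hw,
      fun t ht => hasDerivAt_div_sq_weight (hh0 t (hlabs t ht)).ne' (hh t (hlabs t ht)) (hz t ht),
      fun t ht => ?_, ⟨l, ⟨by linarith, le_rfl⟩, hwl⟩, fun t _ => by simp only [hTdef]; ring,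
      by simp [hz0], by simp [hz1]⟩
    have hzh := hasDerivAt_div_sq_weight (hh0 t (hlabs t ht)).ne' (hh t (hlabs t ht)) (hz t ht)
    exact (((hT t (hlabs t ht)).continuousAt.mul hzh.continuousAt).sub
      (continuousAt_const.mul (hw t ht).continuousAt)).continuousWithinAt
end
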